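/- Let A be a real n × n matrix, let a ≥ 0 and ε > 0 be real numbers, and let x, v ∈ ℝⁿ satisfy ‖v − A x‖ ≤ a ‖x‖ (Euclidean norm). Then v vᵀ ⪯ (1 + ε) a² ‖x‖² I + (1 + ε⁻¹) A (x xᵀ) Aᵀ in the Loewner order, where x xᵀ and v vᵀ denote outer products and I is the n × n identity matrix. -/

import Mathlib

open Matrix

/-- Young's inequality for the square of a sum, with weight `ε`. -/
theorem add_sq_le_one_add_mul_sq {ε : ℝ} (hε : 0 < ε) (p q : ℝ) :
    (p + q) ^ 2 ≤ (1 + ε) * p ^ 2 + (1 + ε⁻¹) * q ^ 2 := by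
  have h : (1 + ε) * p ^ 2 + (1 + ε⁻¹) * q ^ 2 - (p + q) ^ 2 = ε⁻¹ * (ε * p - q) ^ 2 := by
    field_simp
    ring
  have : 0 ≤ ε⁻¹ * (ε * p - q) ^ 2 := by positivity
  linarith

/-- If `v` is within squared Euclidean distance `c` of `w`, then `v vᵀ` is bounded in the Loewner
order by `(1 + ε) c I + (1 + ε⁻¹) w wᵀ`. -/
theorem posSemidef_smul_one_add_vecMulVec_sub_vecMulVec {ι : Type*} [Fintype ι] [DecidableEq ι]
    {ε c : ℝ} (hε : 0 < ε) (v w : ι → ℝ) (h : (v - w) ⬝ᵥ (v - w) ≤ c) :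
    ((1 + ε) • c • (1 : Matrix ι ι ℝ) + (1 + ε⁻¹) • vecMulVec w w - vecMulVec v v).PosSemidef := by
  refine .of_dotProduct_mulVec_nonneg ?_ fun y => ?_
  · simp [IsHermitian, conjTranspose_eq_transpose_of_trivial, transpose_vecMulVec]
  · have hCS : ((v - w) ⬝ᵥ y) ^ 2 ≤ c * (y ⬝ᵥ y) := by
      calc ((v - w) ⬝ᵥ y) ^ 2 ≤ ((v - w) ⬝ᵥ (v - w)) * (y ⬝ᵥ y) := by
            simpa only [dotProduct, sq] using
              Finset.sum_mul_sq_le_sq_mul_sq Finset.univ (v - w) y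
        _ ≤ c * (y ⬝ᵥ y) :=
            mul_le_mul_of_nonneg_right h (by simpa using dotProduct_star_self_nonneg y)
    have hY := add_sq_le_one_add_mul_sq hε ((v - w) ⬝ᵥ y) (w ⬝ᵥ y)
    rw [← add_dotProduct, sub_add_cancel] at hY
    have hc := mul_le_mul_of_nonneg_left hCS (by positivity : 0 ≤ 1 + ε)
    simp only [star_trivial, sub_mulVec, add_mulVec, smul_mulVec, one_mulVec, vecMulVec_mulVec,
      dotProduct_sub, dotProduct_add, dotProduct_smul, op_smul_eq_smul, smul_eq_mul,
      dotProduct_comm y v, dotProduct_comm y w]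
    linarith

/-- Pointwise outer-product bound for a sector-bounded nonlinearity: if
`‖v - A x‖ ≤ a ‖x‖` (Euclidean norm), `a ≥ 0` and `ε > 0`, then
`v vᵀ ⪯ (1 + ε) a² ‖x‖² I + (1 + ε⁻¹) A (x xᵀ) Aᵀ` in the Loewner order. -/
theorem sector_bounded_outer_product_bound
    {n : ℕ} (A : Matrix (Fin n) (Fin n) ℝ) (a ε : ℝ) (ha : 0 ≤ a) (hε : 0 < ε)
    (x v : EuclideanSpace ℝ (Fin n))
    (hsec : ‖v - (EuclideanSpace.equiv (Fin n) ℝ).symm (A.mulVec (fun i => x i))‖ ≤ a * ‖x‖) :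
    ((1 + ε) • (a ^ 2 * ‖x‖ ^ 2) • (1 : Matrix (Fin n) (Fin n) ℝ)
      + (1 + ε⁻¹) • (A * vecMulVec (fun i => x i) (fun i => x i) * Aᵀ)
      - vecMulVec (fun i => v i) (fun i => v i)).PosSemidef := by
  have hA : A * vecMulVec (fun i => x i) (fun i => x i) * Aᵀ =
      vecMulVec (A *ᵥ fun i => x i) (A *ᵥ fun i => x i) := by
    rw [mul_vecMulVec, vecMulVec_mul, vecMul_transpose]
  rw [hA]
  refine posSemidef_smul_one_add_vecMulVec_sub_vecMulVec hε _ _ ?_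
  have h := pow_le_pow_left₀ (norm_nonneg _) hsec 2
  rw [mul_pow, EuclideanSpace.real_norm_sq_eq] at h
  simpa [dotProduct, sq] using h
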